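/- Let K be a field and d ≥ 1. Then d² − n_K(d,1) = g_K(d). -/

import Mathlib

noncomputable section

/-- A map `f : E → F → G` of `K`-modules is bilinear. -/
def IsBilin (K : Type*) [Field K] {E F G : Type*} [AddCommGroup E] [AddCommGroup F]
    [AddCommGroup G] [Module K E] [Module K F] [Module K G] (f : E → F → G) : Prop :=
  (∀ x x' y, f (x + x') y = f x y + f x' y) ∧
  (∀ (c : K) x y, f (c • x) y = c • f x y) ∧
  (∀ x y y', f x (y + y') = f x y + f x y') ∧
  (∀ (c : K) x y, f x (c • y) = c • f x y)

/-- A map `f : E → F → G` is nonsingular if `f x y = 0` implies `x = 0` or `y = 0`. -/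
def Nonsingular {E F G : Type*} [Zero E] [Zero F] [Zero G] (f : E → F → G) : Prop :=
  ∀ x y, f x y = 0 → x = 0 ∨ y = 0

/-- `g_K(d)`: the smallest `k` for which there exists a nonsingular bilinear map
`K^d × K^d → K^k`. -/
def gBil (K : Type*) [Field K] (d : ℕ) : ℕ :=
  sInf {k | ∃ f : (Fin d → K) → (Fin d → K) → (Fin k → K), IsBilin K f ∧ Nonsingular f}

/-- `n_K(d, 1)`: the maximal dimension of a subspace of `M_d(K)` containing no nonzero
matrix of rank at most one. -/
def nRank1 (K : Type*) [Field K] (d : ℕ) : ℕ :=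
  sSup {k | ∃ X : Submodule K (Matrix (Fin d) (Fin d) K), Module.finrank K X = k ∧
    ∀ A ∈ X, A ≠ 0 → ¬ A.rank ≤ 1}

/-- A matrix of rank at most one is an outer product of two vectors. -/
theorem Matrix.exists_eq_vecMulVec_of_rank_le_one {K m n : Type*} [Field K] [Fintype m]
    [Fintype n] {A : Matrix m n K} (hA : A.rank ≤ 1) :
    ∃ x y, A = Matrix.vecMulVec x y := by
  rw [Matrix.rank_eq_finrank_span_cols, finrank_le_one_iff] at hA
  obtain ⟨v, hv⟩ := hA
  choose c hc using fun j : n => hv ⟨A.col j, Submodule.subset_span ⟨j, rfl⟩⟩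
  refine ⟨v, c, ?_⟩
  ext i j
  have h := congrFun (congrArg Subtype.val (hc j)) i
  simp only [Submodule.coe_smul, Pi.smul_apply, smul_eq_mul, Matrix.col_apply] at h
  rw [Matrix.vecMulVec_apply, ← h, mul_comm]

/-- A bilinear map on coordinate spaces extends to a linear map on matrices through the
outer product. -/
theorem IsBilin.exists_linearMap_vecMulVec {K m n G : Type*} [Field K] [Fintype m] [Fintype n]
    [DecidableEq m] [DecidableEq n] [AddCommGroup G] [Module K G]
    {f : (m → K) → (n → K) → G} (hf : IsBilin K f) :
    ∃ L : Matrix m n K →ₗ[K] G, ∀ x y, L (Matrix.vecMulVec x y) = f x y := by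
  obtain ⟨h₁, h₂, h₃, h₄⟩ := hf
  let B : (m → K) →ₗ[K] (n → K) →ₗ[K] G := LinearMap.mk₂ K f h₁ h₂ h₃ h₄
  refine ⟨∑ i, ∑ j, (LinearMap.toSpanSingleton K G (B (Pi.single i 1) (Pi.single j 1))).comp
    (Matrix.entryLinearMap K K i j), fun x y => ?_⟩
  change _ = B x y
  conv_rhs => rw [pi_eq_sum_univ' x, pi_eq_sum_univ' y]
  simp [Matrix.vecMulVec_apply, mul_smul, Finset.smul_sum]
  rw [Finset.sum_comm]
  simp only [smul_smul, mul_comm]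

/-- For every field `K` and `d ≥ 1`, `d² − n_K(d, 1) = g_K(d)`. -/
theorem statement_2 (K : Type*) [Field K] (d : ℕ) (hd : 1 ≤ d) :
    d ^ 2 - nRank1 K d = gBil K d := by
  set N := {k | ∃ X : Submodule K (Matrix (Fin d) (Fin d) K), Module.finrank K X = k ∧
    ∀ A ∈ X, A ≠ 0 → ¬ A.rank ≤ 1} with hN
  set S := {k | ∃ f : (Fin d → K) → (Fin d → K) → (Fin k → K), IsBilin K f ∧ Nonsingular f}
    with hS
  change d ^ 2 - sSup N = sInf S
  have hdim : Module.finrank K (Matrix (Fin d) (Fin d) K) = d ^ 2 := by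
    simp [Module.finrank_matrix, sq]
  have hN_bdd : BddAbove N := by
    refine ⟨d ^ 2, ?_⟩
    rintro _ ⟨X, rfl, -⟩
    exact hdim ▸ X.finrank_le
  have hN_nonempty : N.Nonempty :=
    ⟨0, ⊥, finrank_bot K _, fun A hA hA0 => absurd ((Submodule.mem_bot K).1 hA) hA0⟩
  have hNS : ∀ k ∈ N, d ^ 2 - k ∈ S := by
    rintro _ ⟨X, rfl, hX⟩
    have hq : Module.finrank K (Matrix (Fin d) (Fin d) K ⧸ X) =
        d ^ 2 - Module.finrank K X := by
      have := X.finrank_quotient_add_finrank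
      omega
    let e : (Matrix (Fin d) (Fin d) K ⧸ X) ≃ₗ[K] (Fin (d ^ 2 - Module.finrank K X) → K) :=
      LinearEquiv.ofFinrankEq _ _ (hq.trans (Module.finrank_fin_fun K).symm)
    refine ⟨fun x y => e (X.mkQ (Matrix.vecMulVec x y)), ⟨?_, ?_, ?_, ?_⟩, ?_⟩
    · intro x x' y
      simp only [Matrix.add_vecMulVec, map_add]
    · intro c x y
      simp only [Matrix.smul_vecMulVec, map_smul]
    · intro x y y'
      simp only [Matrix.vecMulVec_add, map_add]
    · intro c x y
      simp only [Matrix.vecMulVec_smul, map_smul]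
    · intro x y hxy
      have hmem : Matrix.vecMulVec x y ∈ X := by simpa using hxy
      have h0 : Matrix.vecMulVec x y = 0 := by
        by_contra h
        exact hX _ hmem h (Matrix.rank_vecMulVec_le x y)
      exact Matrix.vecMulVec_eq_zero.1 h0
  have hSN : ∀ k ∈ S, ∃ n ∈ N, d ^ 2 - k ≤ n := by
    rintro k ⟨f, hf, hns⟩
    obtain ⟨L, hL⟩ := hf.exists_linearMap_vecMulVec
    refine ⟨_, ⟨LinearMap.ker L, rfl, ?_⟩, ?_⟩
    · intro A hA hA0 hrank
      obtain ⟨x, y, rfl⟩ := Matrix.exists_eq_vecMulVec_of_rank_le_one hrank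
      rw [LinearMap.mem_ker, hL] at hA
      rcases hns x y hA with rfl | rfl <;> simp at hA0
    · have h₁ := L.finrank_range_add_finrank_ker
      have h₂ := (LinearMap.range L).finrank_le
      rw [Module.finrank_fin_fun] at h₂
      omega
  have hle : sInf S ≤ d ^ 2 - sSup N := Nat.sInf_le (hNS _ (Nat.sSup_mem hN_nonempty hN_bdd))
  obtain ⟨n, hn, hgn⟩ := hSN _ (Nat.sInf_mem ⟨_, hNS _ (Nat.sSup_mem hN_nonempty hN_bdd)⟩)
  have hn' := le_csSup hN_bdd hn
  omega
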